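/- arXiv:2506.04177 — 9 statements merged into one kernel-verified Lean document; each statement's English description precedes it below -/
import Mathlib

section
/- Let k be a natural number and let P be a polynomial with rational coefficients such that the composition of P with 4X² − 4 equals the Chebyshev polynomial T_{2k} of the first kind over ℚ. Then the composition of P with −X − 4 equals (−1)^k · P. -/
open Polynomial

theorem aux_eq (k : ℕ) (P : ℚ[X])
    (hP : P.comp (4 * X ^ 2 - 4) = Polynomial.Chebyshev.T ℚ (2 * k)) :
    P = (Polynomial.Chebyshev.T ℚ k).comp (C (1/2) * X + 1) := by
  have hC : (4 : ℚ[X]) = C 4 := rfl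
  have hd : (4 * X ^ 2 - 4 : ℚ[X]).natDegree = 2 := by rw [hC]; compute_degree!
  have h0 : (P - (Polynomial.Chebyshev.T ℚ k).comp (C (1/2) * X + 1)).comp (4 * X ^ 2 - 4) = 0 := by
    rw [sub_comp, hP, mul_comm, Polynomial.Chebyshev.T_mul, comp_assoc, Polynomial.Chebyshev.T_two]
    have : (C (1/2) * X + 1 : ℚ[X]).comp (4 * X ^ 2 - 4) = 2 * X ^ 2 - 1 := by
      apply Polynomial.funext
      intro x
      simp
      ring
    rw [this, sub_self]
  rcases comp_eq_zero_iff.1 h0 with h | ⟨_, h⟩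
  · exact sub_eq_zero.1 h
  · rw [h, natDegree_C] at hd
    omega

/-- If `P ∈ ℚ[X]` satisfies `P.comp (4*X^2 - 4) = T_{2k}` (Chebyshev polynomial of the
first kind over `ℚ`), then `P.comp (-X - 4) = (-1)^k • P`. -/
theorem stmt_1 (k : ℕ) (P : ℚ[X])
    (hP : P.comp (4 * X ^ 2 - 4) = Polynomial.Chebyshev.T ℚ (2 * k)) :
    P.comp (-X - 4) = (-1 : ℚ[X]) ^ k * P := by
  rw [aux_eq k P hP]
  apply Polynomial.funext
  intro x
  have h := Polynomial.Chebyshev.T_eval_neg (R := ℚ) k (1/2 * x + 1)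
  have e : (1/2 : ℚ) * (-x - 4) + 1 = -(1/2 * x + 1) := by ring
  simp only [eval_comp, eval_mul, eval_add, eval_C, eval_X, eval_one, eval_sub, eval_neg,
    eval_pow, eval_ofNat]
  rw [e, h]
  simp [Int.negOnePow_def]
end

section
/- For every natural number k, the polynomial Q_k with rational coefficients satisfies the symmetry relation Q_k(−X − 4) = (−1)^k · Q_k(X), i.e., the composition of Q_k with −X − 4 equals (−1)^k · Q_k. -/
open Polynomial

/-- The polynomial `Q_k(T) = ∑_{j=0}^{k} binom(k+j+1, 2j+1) * T^j` with rational
coefficients. -/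
noncomputable def Q (k : ℕ) : ℚ[X] :=
  ∑ j ∈ Finset.range (k + 1), C ((Nat.choose (k + j + 1) (2 * j + 1) : ℚ)) * X ^ j

lemma Q_coeff (k n : ℕ) : (Q k).coeff n = (Nat.choose (k + n + 1) (2 * n + 1) : ℚ) := by
  unfold Q
  simp only [finset_sum_coeff, coeff_C_mul, coeff_X_pow, mul_ite, mul_one, mul_zero,
    Finset.sum_ite_eq, Finset.mem_range]
  split_ifs with h
  · rfl
  · rw [Nat.choose_eq_zero_of_lt (by omega)]; simp

lemma Q_rec (k : ℕ) : Q (k + 2) = (X + 2) * Q (k + 1) - Q k := by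
  ext n
  have h2 : (2 : ℚ[X]) = C 2 := rfl
  rw [add_mul, h2, coeff_sub, coeff_add, coeff_C_mul]
  cases n with
  | zero =>
    simp only [mul_coeff_zero, coeff_X_zero, Q_coeff]
    simp
    ring
  | succ n =>
    rw [coeff_X_mul]
    simp only [Q_coeff]
    have e1 : k + 2 + (n + 1) + 1 = (k + n + 2) + 1 + 1 := by ring
    have e2 : k + 1 + n + 1 = k + n + 2 := by ring
    have e3 : k + 1 + (n + 1) + 1 = k + n + 2 + 1 := by ring
    have e4 : k + (n + 1) + 1 = k + n + 2 := by ring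
    have e5 : 2 * (n + 1) + 1 = 2 * n + 1 + 1 + 1 := by ring
    rw [e1, e2, e3, e4, e5]
    generalize k + n + 2 = m
    generalize 2 * n + 1 = r
    simp only [Nat.choose_succ_succ, Nat.cast_add]
    simp only [Nat.succ_eq_add_one, Nat.choose_succ_succ, Nat.cast_add]
    ring

/-- For every natural number `k`, the polynomial `Q_k` satisfies the symmetry relation
`Q_k(-X - 4) = (-1)^k * Q_k(X)`. -/
theorem stmt_3 (k : ℕ) : (Q k).comp (-X - 4) = (-1 : ℚ[X]) ^ k * Q k := by
  induction k using Nat.twoStepInduction with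
  | zero => simp [Q]
  | one =>
    simp [Q, Finset.sum_range_succ]
    ring
  | more k h0 h1 =>
    have h2 : (2 : ℚ[X]).comp (-X - 4) = 2 := C_comp (a := (2 : ℚ))
    rw [Q_rec, sub_comp, mul_comp, add_comp, X_comp, h0, h1, h2]
    ring
end

section
/- For every natural number k and every nonzero real number x, the evaluation of Q_k at x + x⁻¹ − 2 equals ∑_{j=0}^{k} x^(2j − k), where the exponents 2j − k are integers (possibly negative). -/
open Polynomial

noncomputable def auxA (T : ℝ) (k : ℕ) : ℝ :=
  ∑ j ∈ Finset.range (k + 1), (Nat.choose (k + j + 1) (2 * j + 1) : ℝ) * T ^ j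

noncomputable def auxB (T : ℝ) (k : ℕ) : ℝ :=
  ∑ j ∈ Finset.range (k + 1), (Nat.choose (k + j) (2 * j) : ℝ) * T ^ j

noncomputable def auxS (x : ℝ) (k : ℕ) : ℝ :=
  ∑ j ∈ Finset.range (k + 1), x ^ ((2 * j : ℤ) - (k : ℤ))

theorem auxA_succ (T : ℝ) (k : ℕ) : auxA T (k + 1) = auxA T k + auxB T (k + 1) := by
  have h : auxA T k =
      ∑ j ∈ Finset.range (k + 1 + 1), (Nat.choose (k + j + 1) (2 * j + 1) : ℝ) * T ^ j := by
    rw [Finset.sum_range_succ, Nat.choose_eq_zero_of_lt (by omega)]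
    simp [auxA]
  rw [h, auxA, auxB, ← Finset.sum_add_distrib]
  refine Finset.sum_congr rfl fun j _ => ?_
  have e : k + 1 + j = k + j + 1 := by ring
  rw [e, Nat.choose_succ_succ (k + j + 1) (2 * j)]
  push_cast
  ring

theorem auxB_succ (T : ℝ) (k : ℕ) : auxB T (k + 1) = auxB T k + T * auxA T k := by
  have h : auxB T k =
      ∑ j ∈ Finset.range (k + 1 + 1), (Nat.choose (k + j) (2 * j) : ℝ) * T ^ j := by
    rw [Finset.sum_range_succ, Nat.choose_eq_zero_of_lt (by omega)]
    simp [auxB]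
  rw [h, auxA, auxB, Finset.sum_range_succ', Finset.sum_range_succ' _ (k + 1), Finset.mul_sum,
    add_right_comm (Finset.sum _ _), ← Finset.sum_add_distrib]
  congr 1
  · refine Finset.sum_congr rfl fun j _ => ?_
    have e : k + 1 + (j + 1) = (k + j + 1) + 1 := by ring
    have e2 : 2 * (j + 1) = (2 * j + 1) + 1 := by ring
    have e3 : k + (j + 1) = k + j + 1 := by ring
    rw [e, e2, e3, Nat.choose_succ_succ (k + j + 1) (2 * j + 1)]
    push_cast
    ring
  · simp

theorem auxS_succ (x : ℝ) (hx : x ≠ 0) (k : ℕ) :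
    auxS x (k + 1) = x * auxS x k + x ^ (-(k + 1 : ℤ)) := by
  rw [auxS, auxS, Finset.sum_range_succ', Finset.mul_sum]
  congr 1
  · refine Finset.sum_congr rfl fun j _ => ?_
    rw [← zpow_one_add₀ hx]
    congr 1
    push_cast
    ring

theorem aux_main (x : ℝ) (hx : x ≠ 0) (k : ℕ) :
    auxA (x + x⁻¹ - 2) k = auxS x k ∧ auxA (x + x⁻¹ - 2) (k + 1) = auxS x (k + 1) := by
  induction k with
  | zero =>
    constructor
    · simp [auxA, auxS]
    · simp [auxA, auxS, Finset.sum_range_succ]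
      ring
  | succ k ih =>
    refine ⟨ih.2, ?_⟩
    have h1 := auxA_succ (x + x⁻¹ - 2) k
    have h2 := auxA_succ (x + x⁻¹ - 2) (k + 1)
    have h3 := auxB_succ (x + x⁻¹ - 2) (k + 1)
    have s1 := auxS_succ x hx k
    have s2 := auxS_succ x hx (k + 1)
    have e : x ^ (-(((k + 1 : ℕ) : ℤ) + 1)) = x⁻¹ * x ^ (-(k + 1 : ℤ)) := by
      rw [← zpow_neg_one, ← zpow_add₀ hx]
      congr 1
      push_cast
      ring
    rw [e] at s2
    have s3 : x⁻¹ * auxS x (k + 1) = auxS x k + x⁻¹ * x ^ (-(k + 1 : ℤ)) := by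
      rw [s1, mul_add, inv_mul_cancel_left₀ hx]
    rw [ih.1] at h1
    rw [ih.2] at h1 h2 h3
    linarith

/-- For every natural number `k` and every nonzero real `x`, the evaluation of `Q_k`
at `x + x⁻¹ - 2` equals `∑_{j=0}^{k} x^(2j - k)`, where the exponents are integers. -/
theorem stmt_4 (k : ℕ) (x : ℝ) (hx : x ≠ 0) :
    (Polynomial.aeval (x + x⁻¹ - 2)) (Q k) =
      ∑ j ∈ Finset.range (k + 1), x ^ ((2 * j : ℤ) - (k : ℤ)) := by
  have h := (aux_main x hx k).1
  rw [auxS] at h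
  rw [← h, Q, auxA, map_sum]
  refine Finset.sum_congr rfl fun j _ => ?_
  simp
end

section
/- Let n ≥ 1 be a natural number and let p be a prime number. Then p divides the product ∏_{0 ≤ j < k ≤ n} (r_j² − r_k²) for every (n+1)-tuple of integers (r_0, …, r_n) if and only if p ≤ 2n − 1. -/
/-- For `n ≥ 1` and a prime `p`, the prime `p` divides the product
`∏_{0 ≤ j < k ≤ n} (r_j² - r_k²)` for every tuple of integers `(r_0, …, r_n)`
if and only if `p ≤ 2n - 1`. -/
theorem stmt_7 (n : ℕ) (hn : 1 ≤ n) (p : ℕ) (hp : p.Prime) :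
    (∀ r : ℕ → ℤ, (p : ℤ) ∣
        ∏ j ∈ Finset.range (n + 1), ∏ k ∈ Finset.Ioc j n, ((r j) ^ 2 - (r k) ^ 2)) ↔
      p ≤ 2 * n - 1 := by
  have hpi : Prime (p : ℤ) := Nat.prime_iff_prime_int.mp hp
  constructor
  · intro h
    by_contra hlt
    have h1 := h (fun i => (i : ℤ))
    obtain ⟨j, hj, h2⟩ := (hpi.dvd_finset_prod_iff _).mp h1
    obtain ⟨k, hk, h3⟩ := (hpi.dvd_finset_prod_iff _).mp h2
    rw [Finset.mem_Ioc] at hk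
    have h4 : ((k : ℤ) + j) * ((k : ℤ) - j) = -((j : ℤ) ^ 2 - (k : ℤ) ^ 2) := by ring
    have h5 : (p : ℤ) ∣ ((k : ℤ) + j) * ((k : ℤ) - j) := by
      rw [h4]; exact (dvd_neg).mpr h3
    rcases hpi.dvd_or_dvd h5 with h6 | h6
    · have := Int.le_of_dvd (by omega) h6
      omega
    · have := Int.le_of_dvd (by omega) h6
      omega
  · intro hle r
    haveI : NeZero p := ⟨hp.ne_zero⟩
    have key : ∃ x ∈ Finset.range (n + 1), ∃ y ∈ Finset.range (n + 1), x ≠ y ∧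
        (((r x : ZMod p)).valMinAbs.natAbs) = (((r y : ZMod p)).valMinAbs.natAbs) := by
      apply Finset.exists_ne_map_eq_of_card_lt_of_maps_to (t := Finset.range (p / 2 + 1))
      · simp only [Finset.card_range]; omega
      · intro i _
        have := ZMod.natAbs_valMinAbs_le (r i : ZMod p)
        simp only [Finset.coe_range, Set.mem_Iio]
        omega
    obtain ⟨x, hx, y, hy, hxy, he⟩ := key
    have hsq : (p : ℤ) ∣ r x ^ 2 - r y ^ 2 := by
      rw [← ZMod.intCast_zmod_eq_zero_iff_dvd]
      push_cast
      rw [← ZMod.coe_valMinAbs (r x : ZMod p), ← ZMod.coe_valMinAbs (r y : ZMod p)]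
      rcases Int.natAbs_eq_natAbs_iff.mp he with h | h <;> rw [h] <;> push_cast <;> ring
    rw [Finset.mem_range] at hx hy
    have fin : ∀ a b : ℕ, a < b → b < n + 1 → (p : ℤ) ∣ r a ^ 2 - r b ^ 2 → (p : ℤ) ∣
        ∏ j ∈ Finset.range (n + 1), ∏ k ∈ Finset.Ioc j n, ((r j) ^ 2 - (r k) ^ 2) := by
      intro a b hab hb hd
      refine (hpi.dvd_finset_prod_iff _).mpr ⟨a, Finset.mem_range.mpr (by omega), ?_⟩
      exact (hpi.dvd_finset_prod_iff _).mpr ⟨b, Finset.mem_Ioc.mpr (by omega), hd⟩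
    rcases lt_or_gt_of_ne hxy with h | h
    · exact fin x y h hy hsq
    · exact fin y x h hx ((dvd_sub_comm).mp hsq)
end

section
/- The integer 12 divides the product (r_0² − r_1²)(r_0² − r_2²)(r_1² − r_2²) for all integers r_0, r_1, r_2, and every integer d that divides this product for all integers r_0, r_1, r_2 divides 12. (In other words, the gcd of all such products is 12.) -/
/-- The gcd of all products `(r₀² - r₁²)(r₀² - r₂²)(r₁² - r₂²)` over integers
`r₀, r₁, r₂` is `12`: the integer `12` divides every such product, and every integer
dividing all such products divides `12`. -/
theorem stmt_9 :
    (∀ r₀ r₁ r₂ : ℤ,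
      (12 : ℤ) ∣ (r₀ ^ 2 - r₁ ^ 2) * (r₀ ^ 2 - r₂ ^ 2) * (r₁ ^ 2 - r₂ ^ 2)) ∧
    (∀ d : ℤ,
      (∀ r₀ r₁ r₂ : ℤ,
        d ∣ (r₀ ^ 2 - r₁ ^ 2) * (r₀ ^ 2 - r₂ ^ 2) * (r₁ ^ 2 - r₂ ^ 2)) →
      d ∣ 12) := by
  constructor
  · intro a b c
    have h4 : (4 : ℤ) ∣ (a ^ 2 - b ^ 2) * (a ^ 2 - c ^ 2) * (b ^ 2 - c ^ 2) := by
      have key : ∀ x y z : ZMod 4,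
          (x ^ 2 - y ^ 2) * (x ^ 2 - z ^ 2) * (y ^ 2 - z ^ 2) = 0 := by decide
      have h := key a b c
      exact (ZMod.intCast_zmod_eq_zero_iff_dvd _ 4).1 (by push_cast; exact h)
    have h3 : (3 : ℤ) ∣ (a ^ 2 - b ^ 2) * (a ^ 2 - c ^ 2) * (b ^ 2 - c ^ 2) := by
      have key : ∀ x y z : ZMod 3,
          (x ^ 2 - y ^ 2) * (x ^ 2 - z ^ 2) * (y ^ 2 - z ^ 2) = 0 := by decide
      have h := key a b c
      exact (ZMod.intCast_zmod_eq_zero_iff_dvd _ 3).1 (by push_cast; exact h)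
    omega
  · intro d h
    simpa using h 2 1 0
end

section
/- The integer 4320 = 2⁵·3³·5 divides the product ∏_{0 ≤ j < k ≤ 3} (r_j² − r_k²) for all integers r_0, r_1, r_2, r_3, and every integer d that divides this product for all integers r_0, r_1, r_2, r_3 divides 4320. (In other words, the gcd of all such products is 4320.) -/
/-- Combining pairwise divisibilities by class weights. -/
theorem combine_aux (w : Bool → Bool → ℤ) (m : ℤ) (c : ℤ → Bool)
    (hw : ∀ x y : ℤ, w (c x) (c y) ∣ x ^ 2 - y ^ 2)
    (hm : ∀ p q r s : Bool, m ∣ w p q * w p r * w p s * w q r * w q s * w r s)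
    (a b e f : ℤ) :
    m ∣ (a ^ 2 - b ^ 2) * (a ^ 2 - e ^ 2) * (a ^ 2 - f ^ 2) *
        (b ^ 2 - e ^ 2) * (b ^ 2 - f ^ 2) * (e ^ 2 - f ^ 2) :=
  (hm (c a) (c b) (c e) (c f)).trans
    (mul_dvd_mul (mul_dvd_mul (mul_dvd_mul (mul_dvd_mul (mul_dvd_mul
      (hw a b) (hw a e)) (hw a f)) (hw b e)) (hw b f)) (hw e f))

theorem sq_two_aux (x : ℤ) : if x % 2 = 0 then x ^ 2 % 4 = 0 else x ^ 2 % 8 = 1 := by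
  split_ifs with h
  · obtain ⟨k, rfl⟩ := Int.dvd_of_emod_eq_zero h
    ring_nf; omega
  · have : x % 8 = 1 ∨ x % 8 = 3 ∨ x % 8 = 5 ∨ x % 8 = 7 := by omega
    rcases this with h | h | h | h <;> simp [pow_two, Int.mul_emod, h]

theorem sq_three_aux (x : ℤ) : if x % 3 = 0 then x ^ 2 % 9 = 0 else x ^ 2 % 3 = 1 := by
  split_ifs with h
  · obtain ⟨k, rfl⟩ := Int.dvd_of_emod_eq_zero h
    ring_nf; omega
  · have : x % 3 = 1 ∨ x % 3 = 2 := by omega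
    rcases this with h | h <;> simp [pow_two, Int.mul_emod, h]

theorem dvd32_aux (a b e f : ℤ) :
    32 ∣ (a ^ 2 - b ^ 2) * (a ^ 2 - e ^ 2) * (a ^ 2 - f ^ 2) *
        (b ^ 2 - e ^ 2) * (b ^ 2 - f ^ 2) * (e ^ 2 - f ^ 2) := by
  refine combine_aux
    (fun p q => if p = q then (if p then 4 else 8) else 1) 32
    (fun x => decide (x % 2 = 0)) ?_ (by decide) a b e f
  intro x y
  have hx := sq_two_aux x
  have hy := sq_two_aux y
  by_cases h1 : x % 2 = 0 <;> by_cases h2 : y % 2 = 0 <;>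
    simp only [h1, h2, if_true, if_false] at hx hy <;> simp [h1, h2] <;> omega

theorem dvd27_aux (a b e f : ℤ) :
    27 ∣ (a ^ 2 - b ^ 2) * (a ^ 2 - e ^ 2) * (a ^ 2 - f ^ 2) *
        (b ^ 2 - e ^ 2) * (b ^ 2 - f ^ 2) * (e ^ 2 - f ^ 2) := by
  refine combine_aux
    (fun p q => if p = q then (if p then 9 else 3) else 1) 27
    (fun x => decide (x % 3 = 0)) ?_ (by decide) a b e f
  intro x y
  have hx := sq_three_aux x
  have hy := sq_three_aux y
  by_cases h1 : x % 3 = 0 <;> by_cases h2 : y % 3 = 0 <;>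
    simp only [h1, h2, if_true, if_false] at hx hy <;> simp [h1, h2] <;> omega

set_option maxRecDepth 100000 in
theorem zmod5_aux : ∀ a b e f : ZMod 5,
    (a ^ 2 - b ^ 2) * (a ^ 2 - e ^ 2) * (a ^ 2 - f ^ 2) *
        (b ^ 2 - e ^ 2) * (b ^ 2 - f ^ 2) * (e ^ 2 - f ^ 2) = 0 := by
  decide +kernel

theorem dvd5_aux (a b e f : ℤ) :
    5 ∣ (a ^ 2 - b ^ 2) * (a ^ 2 - e ^ 2) * (a ^ 2 - f ^ 2) *
        (b ^ 2 - e ^ 2) * (b ^ 2 - f ^ 2) * (e ^ 2 - f ^ 2) := by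
  have := zmod5_aux a b e f
  exact (ZMod.intCast_zmod_eq_zero_iff_dvd _ 5).1 (by push_cast; exact this)

/-- The gcd of all products `∏_{0 ≤ j < k ≤ 3} (r_j² - r_k²)` over integers
`r₀, r₁, r₂, r₃` is `4320 = 2⁵·3³·5`: the integer `4320` divides every such product,
and every integer dividing all such products divides `4320`. -/
theorem stmt_10 :
    (∀ r₀ r₁ r₂ r₃ : ℤ,
      (4320 : ℤ) ∣ (r₀ ^ 2 - r₁ ^ 2) * (r₀ ^ 2 - r₂ ^ 2) * (r₀ ^ 2 - r₃ ^ 2) *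
        (r₁ ^ 2 - r₂ ^ 2) * (r₁ ^ 2 - r₃ ^ 2) * (r₂ ^ 2 - r₃ ^ 2)) ∧
    (∀ d : ℤ,
      (∀ r₀ r₁ r₂ r₃ : ℤ,
        d ∣ (r₀ ^ 2 - r₁ ^ 2) * (r₀ ^ 2 - r₂ ^ 2) * (r₀ ^ 2 - r₃ ^ 2) *
          (r₁ ^ 2 - r₂ ^ 2) * (r₁ ^ 2 - r₃ ^ 2) * (r₂ ^ 2 - r₃ ^ 2)) →
      d ∣ 4320) := by
  refine ⟨fun a b e f => ?_, fun d hd => by simpa using hd 0 1 2 3⟩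
  have h1 := dvd32_aux a b e f
  have h2 := dvd27_aux a b e f
  have h3 := dvd5_aux a b e f
  omega
end

section
/- Let n be a natural number, q an integer, and a_0, …, a_n rational numbers such that for every integer r the rational number ∑_{i=0}^{n} a_i·(r²·q)^i is an integer. Then for every index i with 0 ≤ i ≤ n and all integers r_0, …, r_n, the rational number a_i · q^i · ∏_{0 ≤ j < k ≤ n} (r_j² − r_k²) is an integer. -/
/-- Let `q` be an integer and `a_0, …, a_n` rational numbers such that for every integer
`r`, the rational number `∑_{i=0}^{n} a_i (r² q)^i` is an integer. Then for every
`i ≤ n` and all integers `r_0, …, r_n`, the rational number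
`a_i * q^i * ∏_{0 ≤ j < k ≤ n} (r_j² - r_k²)` is an integer. -/
theorem stmt_11 (n : ℕ) (q : ℤ) (a : ℕ → ℚ)
    (h : ∀ r : ℤ, ∃ z : ℤ,
      ∑ i ∈ Finset.range (n + 1), a i * ((r ^ 2 * q : ℤ) : ℚ) ^ i = (z : ℚ)) :
    ∀ i ≤ n, ∀ r : ℕ → ℤ, ∃ z : ℤ,
      a i * (q : ℚ) ^ i *
        ((∏ j ∈ Finset.range (n + 1), ∏ k ∈ Finset.Ioc j n,
          ((r j) ^ 2 - (r k) ^ 2) : ℤ) : ℚ) = (z : ℚ) := by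
  intro i hi r
  choose z hz using h
  let v : Fin (n + 1) → ℤ := fun j => -(r j) ^ 2
  let M := Matrix.vandermonde v
  let b : Fin (n + 1) → ℚ := fun l => a l * (q : ℚ) ^ (l : ℕ) * (-1) ^ (l : ℕ)
  let i' : Fin (n + 1) := ⟨i, by omega⟩
  have hdet : (∏ j ∈ Finset.range (n + 1), ∏ k ∈ Finset.Ioc j n,
      ((r j) ^ 2 - (r k) ^ 2) : ℤ) = M.det := by
    rw [Matrix.det_vandermonde, Finset.prod_range]
    refine Finset.prod_congr rfl fun j _ => ?_
    symm
    refine Finset.prod_bij (fun k _ => (k : ℕ)) ?_ ?_ ?_ ?_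
    · intro k hk
      have h1 := Finset.mem_Ioi.1 hk
      rw [Finset.mem_Ioc]
      exact ⟨h1, by omega⟩
    · intro x _ y _ hxy
      exact Fin.ext hxy
    · intro k hk
      rw [Finset.mem_Ioc] at hk
      exact ⟨⟨k, by omega⟩, Finset.mem_Ioi.2 hk.1, rfl⟩
    · intro k _
      simp only [v]
      ring
  have hM : ∀ j : Fin (n + 1), ∑ l, (M j l : ℚ) * b l = (z (r j) : ℚ) := by
    intro j
    rw [← hz, Finset.sum_range]
    refine Finset.sum_congr rfl fun l _ => ?_
    simp only [M, b, v, Matrix.vandermonde_apply]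
    push_cast
    rw [neg_pow, mul_pow]
    have h1 : ((-1 : ℚ) ^ (l : ℕ)) * (-1) ^ (l : ℕ) = 1 := by
      rw [← mul_pow]; norm_num
    linear_combination (((r j : ℚ) ^ 2) ^ (l : ℕ) * a l * (q : ℚ) ^ (l : ℕ)) * h1
  have hA : ∀ l, ∑ j, (M.adjugate i' j : ℚ) * (M j l : ℚ) =
      if i' = l then (M.det : ℚ) else 0 := by
    intro l
    have := congrFun (congrFun (Matrix.adjugate_mul M) i') l
    rw [Matrix.mul_apply, Matrix.smul_apply, Matrix.one_apply] at this
    have h2 := congrArg (Int.cast : ℤ → ℚ) this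
    push_cast at h2
    rw [h2]
    split_ifs <;> simp
  have key : ∑ j, (M.adjugate i' j : ℚ) * (z (r j) : ℚ) = M.det * b i' := by
    simp_rw [← hM, Finset.mul_sum]
    rw [Finset.sum_comm]
    simp_rw [← mul_assoc, ← Finset.sum_mul, hA]
    simp
  refine ⟨(-1) ^ i * ∑ j, M.adjugate i' j * z (r j), ?_⟩
  rw [hdet]
  generalize M.det = D at key ⊢
  push_cast
  rw [key]
  have h1 : ((-1 : ℚ) ^ i) * (-1) ^ i = 1 := by
    rw [← mul_pow]; norm_num
  simp only [b, i']
  linear_combination (-(a i * (q : ℚ) ^ i * D)) * h1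
end

section
/- Let P be a polynomial with rational coefficients of degree n ≥ 1 and suppose there is an integer N such that P(2m) is an integer for every integer m ≥ N. Then the leading coefficient of P lies in (1/(2^n · n!))·ℤ, i.e., 2^n · n! times the leading coefficient of P is an integer. -/
open Polynomial

/-- Let `P ∈ ℚ[X]` have degree `n ≥ 1` and suppose there is an integer `N` such that
`P(2m)` is an integer for every integer `m ≥ N`. Then `2^n * n!` times the leading
coefficient of `P` is an integer. -/
theorem stmt_12 (n : ℕ) (hn : 1 ≤ n) (P : ℚ[X]) (hdeg : P.natDegree = n)
    (N : ℤ) (h : ∀ m : ℤ, N ≤ m → ∃ z : ℤ, P.eval ((2 * m : ℤ) : ℚ) = (z : ℚ)) :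
    ∃ z : ℤ, (2 ^ n * n.factorial : ℚ) * P.leadingCoeff = (z : ℚ) := by
  have hl : (C (2:ℚ) * X).natDegree = 1 := natDegree_C_mul_X 2 (by norm_num)
  have hd : (P.comp (C 2 * X)).natDegree = n := by
    rw [natDegree_comp, hl, hdeg, mul_one]
  have hc : (P.comp (C 2 * X)).leadingCoeff = P.leadingCoeff * 2 ^ n := by
    rw [leadingCoeff_comp (by rw [hl]; norm_num), hdeg, leadingCoeff_C_mul_X]
  have key := congrFun (P.comp (C 2 * X)).fwdDiff_iter_degree_eq_factorial (N : ℚ)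
  rw [hd, hc, fwdDiff_iter_eq_sum_shift] at key
  have h' : ∀ k : ℕ, ∃ z : ℤ, (P.comp (C 2 * X)).eval ((N : ℚ) + k • (1 : ℚ)) = (z : ℚ) := by
    intro k
    obtain ⟨z, hz⟩ := h (N + k) (by omega)
    refine ⟨z, ?_⟩
    rw [← hz]
    simp
  choose f hf using h'
  refine ⟨∑ k ∈ Finset.range (n + 1), ((-1 : ℤ) ^ (n - k) * n.choose k) * f k, ?_⟩
  simp only [hf] at key
  simp only [zsmul_eq_mul, Pi.smul_apply, smul_eq_mul, Pi.natCast_apply] at key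
  push_cast at key ⊢
  rw [key]
  ring
end

section
/- Let n be a natural number, c a rational number, and P a polynomial with rational coefficients of degree at most n satisfying the symmetry relation P(−T − 2c) = (−1)^n · P(T) (i.e., the composition of P with −X − 2c equals (−1)^n · P). Then P is a ℚ-linear combination of the polynomials (T + c)^(n − 2j) for 0 ≤ j ≤ ⌊n/2⌋; that is, P lies in the ℚ-linear span of these polynomials. -/
open Polynomial

/-- Let `P ∈ ℚ[X]` have degree at most `n` and satisfy `P(-T - 2c) = (-1)^n P(T)`.
Then `P` lies in the `ℚ`-linear span of the polynomials `(T + c)^(n - 2j)` for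
`0 ≤ j ≤ n/2`. -/
theorem stmt_13 (n : ℕ) (c : ℚ) (P : ℚ[X]) (hdeg : P.natDegree ≤ n)
    (hsym : P.comp (-X - C (2 * c)) = (-1 : ℚ[X]) ^ n * P) :
    P ∈ Submodule.span ℚ {g : ℚ[X] | ∃ j ≤ n / 2, g = (X + C c) ^ (n - 2 * j)} := by
  set Q : ℚ[X] := P.comp (X - C c) with hQ
  have hPQ : P = Q.comp (X + C c) := by
    simp [hQ, comp_assoc]
  have hQd : Q.natDegree ≤ n := by
    rw [hQ, natDegree_comp, natDegree_X_sub_C, mul_one]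
    exact hdeg
  have hQs : Q.comp (-X) = (-1 : ℚ[X]) ^ n * Q := by
    have h := congrArg (fun R : ℚ[X] => R.comp (X - C c)) hsym
    simp only [comp_assoc, mul_comp, pow_comp, neg_comp, one_comp, sub_comp, X_comp, C_comp] at h
    rw [hQ, ← h, comp_assoc]
    congr 1
    simp only [sub_comp, X_comp, C_comp, C_mul]
    have : (C (2:ℚ) : ℚ[X]) = 2 := rfl
    rw [this]
    ring
  have hco : ∀ k, (-1 : ℚ) ^ k * Q.coeff k = (-1 : ℚ) ^ n * Q.coeff k := by
    intro k
    have h := congrArg (fun R : ℚ[X] => R.coeff k) hQs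
    have h2 : ((-1 : ℚ[X]) ^ n) = C ((-1 : ℚ) ^ n) := by simp
    simp only [h2, coeff_C_mul] at h
    rw [← h, show (-X : ℚ[X]) = C (-1) * X by simp, comp_C_mul_X_coeff, mul_comm]
  rw [hPQ, Q.as_sum_range_C_mul_X_pow' (Nat.lt_succ_of_le hQd), sum_comp]
  refine Submodule.sum_mem _ fun k hk => ?_
  have hkn : k ≤ n := Nat.lt_succ_iff.mp (Finset.mem_range.mp hk)
  rw [mul_comp, C_comp, pow_comp, X_comp, ← smul_eq_C_mul]
  by_cases h0 : Q.coeff k = 0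
  · simp [h0]
  · have hp := mul_right_cancel₀ h0 (hco k)
    refine Submodule.smul_mem _ _ (Submodule.subset_span ?_)
    have hpar : Even k ↔ Even n := by
      rcases Nat.even_or_odd k with a | a <;> rcases Nat.even_or_odd n with b | b
      · simp [a, b]
      · rw [a.neg_one_pow, b.neg_one_pow] at hp; norm_num at hp
      · rw [a.neg_one_pow, b.neg_one_pow] at hp; norm_num at hp
      · simp [Nat.not_even_iff_odd.mpr a, Nat.not_even_iff_odd.mpr b]
    rw [Nat.even_iff, Nat.even_iff] at hpar
    refine ⟨(n - k) / 2, by omega, ?_⟩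
    congr 1
    omega
end
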